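/- Let $T$ be a contraction on both $L^1(\Omega)$ and $L^\infty(\Omega)$ for a measure space $(\Omega,\mu)$. Then for every $1 \leq p \leq \infty$, $T$ is contractively regular on $L^p(\Omega)$: for any finite sequence $(x_k)_{k\geq 1}$ in $L^p(\Omega)$, $\|\sup_k |T x_k|\|_{L^p} \leq \|\sup_k |x_k|\|_{L^p}$. -/

import Mathlib

open MeasureTheory
open scoped ENNReal

/-- The vector-valued function `ω ↦ (x k ω)ₖ` attached to a family of classes of functions. -/
noncomputable def jointFun {Ω ι : Type*} [MeasurableSpace Ω] {μ : Measure Ω}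
    (x : ι → (Ω →ₘ[μ] ℂ)) (ω : Ω) : ι → ℂ := fun k => x k ω

section

variable {ι : Type*} [Fintype ι]

theorem pi_norm_eq_iSup_norm {E : Type*} [SeminormedAddCommGroup E] (v : ι → E) :
    ‖v‖ = ⨆ k, ‖v k‖ :=
  le_antisymm
    ((pi_norm_le_iff_of_nonneg (Real.iSup_nonneg fun _ => norm_nonneg _)).2 fun k =>
      le_ciSup (f := fun k => ‖v k‖) (Set.finite_range _).bddAbove k)
    (Real.iSup_le (fun k => norm_le_pi_norm v k) (norm_nonneg _))

theorem pi_enorm_le {E : Type*} [SeminormedAddCommGroup E] {v : ι → E} {C : ℝ≥0∞}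
    (h : ∀ k, ‖v k‖ₑ ≤ C) : ‖v‖ₑ ≤ C := by
  cases C with
  | top => exact le_top
  | coe C =>
    simp only [enorm_le_coe] at h ⊢
    exact (pi_nnnorm_le_iff).2 h

theorem enorm_le_pi_enorm {E : Type*} [SeminormedAddCommGroup E] (v : ι → E) (k : ι) :
    ‖v k‖ₑ ≤ ‖v‖ₑ :=
  enorm_le_iff_norm_le.2 (norm_le_pi_norm v k)

variable {Ω : Type*} [MeasurableSpace Ω] {μ : Measure Ω}

theorem lintegral_posPart_sub_eq_lintegral_meas_lt {f : Ω → ℝ} (hf : AEMeasurable f μ) (t : ℝ) :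
    ∫⁻ ω, ENNReal.ofReal (f ω - t) ∂μ = ∫⁻ s in Set.Ioi t, μ {ω | s < f ω} := by
  have h := lintegral_eq_lintegral_meas_lt μ (f := fun ω => max (f ω - t) 0)
    (.of_forall fun ω => le_max_right _ _) (by fun_prop)
  simp only [ENNReal.ofReal_max, ENNReal.ofReal_zero, max_zero] at h
  rw [h]
  have h2 := (measurePreserving_add_right volume t).setLIntegral_comp_emb
    (MeasurableEquiv.addRight t).measurableEmbedding (fun s => μ {ω | s < f ω}) (Set.Ioi 0)
  simp only [Set.image_add_const_Ioi, zero_add] at h2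
  rw [← h2]
  refine setLIntegral_congr_fun measurableSet_Ioi fun s hs => ?_
  congr 1 with ω
  simp [lt_sub_iff_add_lt, (Set.mem_Ioi.1 hs).not_gt]

theorem lintegral_rpow_eq_lintegral_posPart_sub {f : Ω → ℝ} (hf : AEMeasurable f μ)
    (hf0 : 0 ≤ f) {p : ℝ} (hp : 1 < p) :
    ∫⁻ ω, ENNReal.ofReal (f ω ^ p) ∂μ = ENNReal.ofReal p * (ENNReal.ofReal (p - 1) *
      ∫⁻ t in Set.Ioi 0, (∫⁻ ω, ENNReal.ofReal (f ω - t) ∂μ) * ENNReal.ofReal (t ^ (p - 2))) := by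
  have hN : Measurable fun s => μ {ω | s < f ω} :=
    Antitone.measurable fun s t hst => measure_mono fun ω (h : t < f ω) => hst.trans_lt h
  rw [lintegral_rpow_eq_lintegral_meas_lt_mul μ (.of_forall hf0) hf (by linarith)]
  congr 1
  have h := lintegral_rpow_eq_lintegral_meas_lt_mul (f := fun s : ℝ => s) (p := p - 1)
    ((volume.restrict (Set.Ioi 0)).withDensity fun s => μ {ω | s < f ω})
    ((withDensity_absolutelyContinuous _ _).ae_le
      ((ae_restrict_mem measurableSet_Ioi).mono fun s hs => le_of_lt hs))
    (by fun_prop) (by linarith)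
  rw [lintegral_withDensity_eq_lintegral_mul _ hN (by fun_prop)] at h
  refine h.trans ?_
  congr 1
  refine setLIntegral_congr_fun measurableSet_Ioi fun t ht => ?_
  rw [lintegral_posPart_sub_eq_lintegral_meas_lt hf]
  congr 1
  · change (Measure.withDensity _ _) (Set.Ioi t) = _
    rw [withDensity_apply _ measurableSet_Ioi, Measure.restrict_restrict measurableSet_Ioi,
      Set.inter_eq_left.2 (Set.Ioi_subset_Ioi (le_of_lt ht))]
  · ring_nf

theorem aestronglyMeasurable_jointFun (x : ι → (Ω →ₘ[μ] ℂ)) :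
    AEStronglyMeasurable (jointFun x) μ :=
  (aemeasurable_pi_lambda _ fun k => (x k).aestronglyMeasurable.aemeasurable).aestronglyMeasurable

theorem jointFun_sub (x y : ι → (Ω →ₘ[μ] ℂ)) :
    jointFun (x - y) =ᵐ[μ] jointFun x - jointFun y := by
  have h : ∀ᵐ ω ∂μ, ∀ k, (x k - y k : Ω →ₘ[μ] ℂ) ω = x k ω - y k ω :=
    ae_all_iff.2 fun k => AEEqFun.coeFn_sub (x k) (y k)
  filter_upwards [h] with ω hω
  exact funext hω

theorem exists_jointFun_eq {G : Ω → ι → ℂ} (hG : AEStronglyMeasurable G μ) :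
    ∃ z : ι → (Ω →ₘ[μ] ℂ), jointFun z =ᵐ[μ] G := by
  have hk (k : ι) : AEStronglyMeasurable (fun ω => G ω k) μ :=
    (continuous_apply k).comp_aestronglyMeasurable hG
  refine ⟨fun k => AEEqFun.mk _ (hk k), ?_⟩
  filter_upwards [ae_all_iff.2 fun k => AEEqFun.coeFn_mk _ (hk k)] with ω hω
  exact funext hω

theorem eLpNorm_top_jointFun_map_le {T : (Ω →ₘ[μ] ℂ) → (Ω →ₘ[μ] ℂ)}
    (hinf : ∀ f : Ω →ₘ[μ] ℂ, eLpNorm (T f) ∞ μ ≤ eLpNorm f ∞ μ) (x : ι → (Ω →ₘ[μ] ℂ)) :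
    eLpNorm (jointFun fun k => T (x k)) ∞ μ ≤ eLpNorm (jointFun x) ∞ μ := by
  have hT (k : ι) : ∀ᵐ ω ∂μ, ‖T (x k) ω‖ₑ ≤ eLpNorm (jointFun x) ∞ μ := by
    have hk : eLpNorm (T (x k)) ∞ μ ≤ eLpNorm (jointFun x) ∞ μ :=
      (hinf (x k)).trans (eLpNorm_mono_enorm fun ω => enorm_le_pi_enorm (jointFun x ω) k)
    filter_upwards [enorm_ae_le_eLpNormEssSup (T (x k)) μ] with ω hω
    exact hω.trans (by simpa using hk)
  rw [eLpNorm_exponent_top]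
  refine essSup_le_of_ae_le _ ?_
  filter_upwards [ae_all_iff.2 hT] with ω hω
  exact pi_enorm_le hω

theorem eLpNorm_one_jointFun_map_le_of_simpleFunc {T : (Ω →ₘ[μ] ℂ) →ₗ[ℂ] (Ω →ₘ[μ] ℂ)}
    (h1 : ∀ f : Ω →ₘ[μ] ℂ, eLpNorm (T f) 1 μ ≤ eLpNorm f 1 μ) {x : ι → (Ω →ₘ[μ] ℂ)}
    {G : SimpleFunc Ω (ι → ℂ)} (hG : jointFun x =ᵐ[μ] G) :
    eLpNorm (jointFun fun k => T (x k)) 1 μ ≤ eLpNorm (jointFun x) 1 μ := by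
  classical
  have hm (c : ι → ℂ) : AEStronglyMeasurable ((G ⁻¹' {c}).indicator fun _ => (1 : ℂ)) μ :=
    aestronglyMeasurable_const.indicator (G.measurableSet_fiber c)
  set e : (ι → ℂ) → (Ω →ₘ[μ] ℂ) := fun c => AEEqFun.mk _ (hm c)
  have he1 (c : ι → ℂ) : ∫⁻ ω, ‖T (e c) ω‖ₑ ∂μ ≤ μ (G ⁻¹' {c}) := by
    rw [← eLpNorm_one_eq_lintegral_enorm]
    refine (h1 _).trans_eq ?_
    rw [eLpNorm_congr_ae (AEEqFun.coeFn_mk _ (hm c)),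
      eLpNorm_indicator_const (G.measurableSet_fiber c) one_ne_zero ENNReal.one_ne_top]
    simp
  have hx (k : ι) : x k = ∑ c ∈ G.range, c k • e c := by
    refine AEEqFun.ext ?_
    filter_upwards [hG, AEEqFun.coeFn_fun_finsetSum G.range fun c => c k • e c,
      (ae_ball_iff G.range.countable_toSet).2 fun c _ => AEEqFun.coeFn_smul (c k) (e c),
      (ae_ball_iff G.range.countable_toSet).2 fun c _ => AEEqFun.coeFn_mk _ (hm c)]
      with ω h h2 h3 h4
    rw [h2, Finset.sum_congr rfl fun c hc => (h3 c hc).trans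
      (congrArg (c k • ·) (h4 c hc))]
    have h5 : x k ω = G ω k := congrFun h k
    simp [h5, Set.indicator_apply, Finset.sum_ite_eq]
  have hTx : ∀ᵐ ω ∂μ, ∀ k, T (x k) ω = ∑ c ∈ G.range, c k * T (e c) ω := by
    refine ae_all_iff.2 fun k => ?_
    rw [hx k, map_sum]
    filter_upwards [AEEqFun.coeFn_fun_finsetSum G.range fun c => T (c k • e c),
      (ae_ball_iff G.range.countable_toSet).2 fun c _ => AEEqFun.coeFn_smul (c k) (T (e c))]
      with ω h2 h3
    rw [h2]
    refine Finset.sum_congr rfl fun c hc => ?_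
    rw [map_smul]
    exact h3 c hc
  rw [eLpNorm_congr_ae hG, eLpNorm_one_eq_lintegral_enorm, eLpNorm_one_eq_lintegral_enorm]
  calc ∫⁻ ω, ‖jointFun (fun k => T (x k)) ω‖ₑ ∂μ
      ≤ ∫⁻ ω, ∑ c ∈ G.range, ‖c‖ₑ * ‖T (e c) ω‖ₑ ∂μ := by
        refine lintegral_mono_ae ?_
        filter_upwards [hTx] with ω hω
        refine pi_enorm_le fun k => ?_
        rw [jointFun, hω k]
        refine (enorm_sum_le _ _).trans (Finset.sum_le_sum fun c _ => ?_)
        rw [enorm_mul]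
        gcongr
        exact enorm_le_pi_enorm c k
    _ = ∑ c ∈ G.range, ‖c‖ₑ * ∫⁻ ω, ‖T (e c) ω‖ₑ ∂μ := by
        have hme (c : ι → ℂ) : AEMeasurable (fun ω => ‖T (e c) ω‖ₑ) μ :=
          (T (e c)).aestronglyMeasurable.enorm
        rw [lintegral_finsetSum' _ fun c _ => (hme c).const_mul _]
        exact Finset.sum_congr rfl fun c _ => lintegral_const_mul'' _ (hme c)
    _ ≤ ∑ c ∈ G.range, ‖c‖ₑ * μ (G ⁻¹' {c}) := by
        gcongr with c
        exact he1 c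
    _ = ∫⁻ ω, ‖G ω‖ₑ ∂μ := by
        rw [← SimpleFunc.map_lintegral, ← SimpleFunc.lintegral_eq_lintegral]
        rfl

theorem eLpNorm_one_jointFun_map_le {T : (Ω →ₘ[μ] ℂ) →ₗ[ℂ] (Ω →ₘ[μ] ℂ)}
    (h1 : ∀ f : Ω →ₘ[μ] ℂ, eLpNorm (T f) 1 μ ≤ eLpNorm f 1 μ) (x : ι → (Ω →ₘ[μ] ℂ)) :
    eLpNorm (jointFun fun k => T (x k)) 1 μ ≤ eLpNorm (jointFun x) 1 μ := by
  have hcrude (y : ι → (Ω →ₘ[μ] ℂ)) :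
      eLpNorm (jointFun fun k => T (y k)) 1 μ ≤ Fintype.card ι * eLpNorm (jointFun y) 1 μ := by
    calc eLpNorm (jointFun fun k => T (y k)) 1 μ
        ≤ ∫⁻ ω, ∑ k, ‖T (y k) ω‖ₑ ∂μ := by
          rw [eLpNorm_one_eq_lintegral_enorm]
          exact lintegral_mono fun ω => pi_enorm_le fun k =>
            Finset.single_le_sum (f := fun k => ‖T (y k) ω‖ₑ) (fun _ _ => zero_le)
              (Finset.mem_univ k)
      _ = ∑ k, eLpNorm (T (y k)) 1 μ := by
          rw [lintegral_finsetSum' _ fun k _ => (T (y k)).aestronglyMeasurable.enorm]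
          simp only [eLpNorm_one_eq_lintegral_enorm]
      _ ≤ ∑ _k : ι, eLpNorm (jointFun y) 1 μ := by
          gcongr with k
          exact (h1 _).trans (eLpNorm_mono_enorm fun ω => enorm_le_pi_enorm (jointFun y ω) k)
      _ = _ := by simp
  by_cases htop : eLpNorm (jointFun x) 1 μ = ∞
  · simp [htop]
  have hmem : MemLp (jointFun x) 1 μ :=
    ⟨aestronglyMeasurable_jointFun x, lt_top_iff_ne_top.2 htop⟩
  have hstep (δ : ℝ≥0∞) (hδ : δ ≠ 0) : eLpNorm (jointFun fun k => T (x k)) 1 μ ≤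
      eLpNorm (jointFun x) 1 μ + (1 + Fintype.card ι) * δ := by
    obtain ⟨G, hG, -⟩ := hmem.exists_simpleFunc_eLpNorm_sub_lt ENNReal.one_ne_top hδ
    obtain ⟨z, hz⟩ := exists_jointFun_eq (μ := μ) G.aestronglyMeasurable
    have hxz : eLpNorm (jointFun (x - z)) 1 μ ≤ δ := by
      rw [eLpNorm_congr_ae ((jointFun_sub x z).trans (Filter.EventuallyEq.rfl.sub hz))]
      exact hG.le
    have hzx : eLpNorm (jointFun z) 1 μ ≤ eLpNorm (jointFun x) 1 μ + δ := by
      have h : jointFun z =ᵐ[μ] jointFun x - jointFun (x - z) := by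
        filter_upwards [jointFun_sub x z] with ω hω
        simp [hω]
      rw [eLpNorm_congr_ae h]
      refine (eLpNorm_sub_le (aestronglyMeasurable_jointFun _) (aestronglyMeasurable_jointFun _)
        le_rfl).trans ?_
      gcongr
    have hT : (jointFun fun k => T (x k)) =ᵐ[μ]
        (jointFun fun k => T (z k)) + jointFun fun k => T ((x - z) k) := by
      have h : (fun k => T ((x - z) k)) = (fun k => T (x k)) - fun k => T (z k) := by
        ext1 k; simp
      rw [h]
      filter_upwards [jointFun_sub (fun k => T (x k)) fun k => T (z k)] with ω hω
      simp [hω]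
    rw [eLpNorm_congr_ae hT]
    refine (eLpNorm_add_le (aestronglyMeasurable_jointFun fun k => T (z k))
      (aestronglyMeasurable_jointFun fun k => T ((x - z) k)) le_rfl).trans ?_
    calc _ ≤ (eLpNorm (jointFun x) 1 μ + δ) + Fintype.card ι * δ := by
          gcongr
          · exact (eLpNorm_one_jointFun_map_le_of_simpleFunc h1 hz).trans hzx
          · exact (hcrude _).trans (by gcongr)
      _ = _ := by ring
  refine ENNReal.le_of_forall_pos_le_add fun ε hε _ => ?_
  have hN0 : (1 + Fintype.card ι : ℝ≥0∞) ≠ 0 := by simp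
  have hNt : (1 + Fintype.card ι : ℝ≥0∞) ≠ ∞ := by simp
  have h := hstep (ε / (1 + Fintype.card ι)) (by simp [hε.ne'])
  rwa [ENNReal.mul_div_cancel hN0 hNt] at h

/-- The excess of `sup |T x k|` over a level `t` is controlled by that of `sup |x k|`: the part of
`x` truncated at height `t` contributes at most `t` to `T x`, and the rest is bounded in `L^1`. -/
theorem lintegral_norm_jointFun_map_sub_le {T : (Ω →ₘ[μ] ℂ) →ₗ[ℂ] (Ω →ₘ[μ] ℂ)}
    (h1 : ∀ f : Ω →ₘ[μ] ℂ, eLpNorm (T f) 1 μ ≤ eLpNorm f 1 μ)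
    (hinf : ∀ f : Ω →ₘ[μ] ℂ, eLpNorm (T f) ∞ μ ≤ eLpNorm f ∞ μ) (x : ι → (Ω →ₘ[μ] ℂ))
    {t : ℝ} (ht : 0 < t) :
    ∫⁻ ω, ENNReal.ofReal (‖jointFun (fun k => T (x k)) ω‖ - t) ∂μ ≤
      ∫⁻ ω, ENNReal.ofReal (‖jointFun x ω‖ - t) ∂μ := by
  set P : (ι → ℂ) → (ι → ℂ) := fun v => min 1 (t / ‖v‖) • v with hP
  have hPm : Measurable P := by fun_prop
  have hPt (v : ι → ℂ) : ‖P v‖ ≤ t := by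
    rw [hP, norm_smul, Real.norm_of_nonneg (by positivity)]
    rcases (norm_nonneg v).eq_or_lt with hv | hv
    · simp [← hv, ht.le]
    · calc _ ≤ t / ‖v‖ * ‖v‖ := by gcongr; exact min_le_right _ _
        _ = t := by field_simp
  have hPsub (v : ι → ℂ) : ‖v - P v‖ₑ ≤ ENNReal.ofReal (‖v‖ - t) := by
    rw [← ofReal_norm]
    have hvP : v - P v = (1 - min 1 (t / ‖v‖)) • v := by simp [hP, sub_smul]
    rw [hvP, norm_smul, Real.norm_of_nonneg (by simp)]
    rcases le_or_gt ‖v‖ t with hv | hv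
    · rcases (norm_nonneg v).eq_or_lt with hv0 | hv0
      · simp [← hv0]
      · simp [min_eq_left ((one_le_div hv0).2 hv)]
    · have hv0 : 0 < ‖v‖ := ht.trans hv
      rw [min_eq_right ((div_le_one hv0).2 hv.le)]
      apply le_of_eq
      congr 1
      field_simp
  obtain ⟨z, hz⟩ := exists_jointFun_eq (μ := μ) (G := fun ω => P (jointFun x ω))
    (hPm.comp_aemeasurable (aestronglyMeasurable_jointFun x).aemeasurable).aestronglyMeasurable
  have hTz : ∀ᵐ ω ∂μ, ‖jointFun (fun k => T (z k)) ω‖ ≤ t := by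
    have h : eLpNorm (jointFun fun k => T (z k)) ∞ μ ≤ ENNReal.ofReal t := by
      refine (eLpNorm_top_jointFun_map_le hinf z).trans ?_
      rw [eLpNorm_congr_ae hz, eLpNorm_exponent_top]
      exact eLpNormEssSup_le_of_ae_bound (.of_forall fun ω => hPt _)
    filter_upwards [enorm_ae_le_eLpNormEssSup (jointFun fun k => T (z k)) μ] with ω hω
    rw [← ENNReal.ofReal_le_ofReal_iff ht.le, ofReal_norm]
    exact hω.trans (by simpa using h)
  calc ∫⁻ ω, ENNReal.ofReal (‖jointFun (fun k => T (x k)) ω‖ - t) ∂μ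
      ≤ ∫⁻ ω, ‖jointFun (fun k => T ((x - z) k)) ω‖ₑ ∂μ := by
        refine lintegral_mono_ae ?_
        have h : (fun k => T ((x - z) k)) = (fun k => T (x k)) - fun k => T (z k) := by
          ext1 k; simp
        rw [h]
        filter_upwards [hTz, jointFun_sub (fun k => T (x k)) fun k => T (z k)] with ω hω h2
        rw [h2, ← ofReal_norm]
        refine ENNReal.ofReal_le_ofReal ?_
        have := norm_sub_norm_le (jointFun (fun k => T (x k)) ω) (jointFun (fun k => T (z k)) ω)
        simp only [Pi.sub_apply]
        linarith
    _ ≤ ∫⁻ ω, ‖jointFun (x - z) ω‖ₑ ∂μ := by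
        simpa only [eLpNorm_one_eq_lintegral_enorm] using eLpNorm_one_jointFun_map_le h1 (x - z)
    _ ≤ _ := by
        refine lintegral_mono_ae ?_
        filter_upwards [hz, jointFun_sub x z] with ω h2 h3
        rw [h3, Pi.sub_apply, h2]
        exact hPsub _

theorem eLpNorm_jointFun_map_le {T : (Ω →ₘ[μ] ℂ) →ₗ[ℂ] (Ω →ₘ[μ] ℂ)}
    (h1 : ∀ f : Ω →ₘ[μ] ℂ, eLpNorm (T f) 1 μ ≤ eLpNorm f 1 μ)
    (hinf : ∀ f : Ω →ₘ[μ] ℂ, eLpNorm (T f) ∞ μ ≤ eLpNorm f ∞ μ)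
    {p : ℝ≥0∞} (hp : 1 ≤ p) (x : ι → (Ω →ₘ[μ] ℂ)) :
    eLpNorm (jointFun fun k => T (x k)) p μ ≤ eLpNorm (jointFun x) p μ := by
  rcases eq_or_ne p ∞ with rfl | hptop
  · exact eLpNorm_top_jointFun_map_le hinf x
  rcases hp.eq_or_lt with rfl | hp1
  · exact eLpNorm_one_jointFun_map_le h1 x
  have hp0 : p ≠ 0 := (one_pos.trans hp1).ne'
  have hpr : 1 < p.toReal := by
    simpa using (ENNReal.toReal_lt_toReal ENNReal.one_ne_top hptop).2 hp1
  have hpow (y : ι → (Ω →ₘ[μ] ℂ)) : ∫⁻ ω, ‖jointFun y ω‖ₑ ^ p.toReal ∂μ =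
      ENNReal.ofReal p.toReal * (ENNReal.ofReal (p.toReal - 1) * ∫⁻ t in Set.Ioi 0,
        (∫⁻ ω, ENNReal.ofReal (‖jointFun y ω‖ - t) ∂μ) * ENNReal.ofReal (t ^ (p.toReal - 2))) := by
    rw [← lintegral_rpow_eq_lintegral_posPart_sub
      (aestronglyMeasurable_jointFun y).norm.aemeasurable (fun ω => norm_nonneg _) hpr]
    refine lintegral_congr fun ω => ?_
    rw [← ofReal_norm, ENNReal.ofReal_rpow_of_nonneg (norm_nonneg _) (by linarith)]
  rw [eLpNorm_eq_lintegral_rpow_enorm_toReal hp0 hptop,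
    eLpNorm_eq_lintegral_rpow_enorm_toReal hp0 hptop, hpow, hpow]
  gcongr ?_ ^ _
  gcongr _ * (_ * ?_)
  refine setLIntegral_mono' measurableSet_Ioi fun t ht => ?_
  gcongr ?_ * _
  exact lintegral_norm_jointFun_map_sub_le h1 hinf x ht

end

/-- if `T` is a linear operator (on classes of measurable functions on a
measure space `Ω`) which is simultaneously a contraction on `L^1(Ω)` and on `L^∞(Ω)`,
then for every `1 ≤ p ≤ ∞`, `T` is contractively regular on `L^p(Ω)`: for every finite
sequence `(x_k)` one has `‖sup_k |T x_k|‖_{L^p} ≤ ‖sup_k |x_k|‖_{L^p}`. -/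
theorem contractively_regular_of_L1_Linfty_contraction
    {Ω : Type*} [MeasurableSpace Ω] (μ : Measure Ω)
    (T : (Ω →ₘ[μ] ℂ) →ₗ[ℂ] (Ω →ₘ[μ] ℂ))
    (h1 : ∀ f : Ω →ₘ[μ] ℂ, eLpNorm (T f) 1 μ ≤ eLpNorm f 1 μ)
    (hinf : ∀ f : Ω →ₘ[μ] ℂ, eLpNorm (T f) ∞ μ ≤ eLpNorm f ∞ μ)
    (p : ℝ≥0∞) (hp : 1 ≤ p) (n : ℕ) (x : Fin n → (Ω →ₘ[μ] ℂ)) :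
    eLpNorm (fun ω => ⨆ k : Fin n, ‖(T (x k)) ω‖) p μ ≤
      eLpNorm (fun ω => ⨆ k : Fin n, ‖(x k) ω‖) p μ := by
  have h (y : Fin n → (Ω →ₘ[μ] ℂ)) :
      (fun ω => ⨆ k : Fin n, ‖(y k) ω‖) = fun ω => ‖jointFun y ω‖ :=
    funext fun ω => (pi_norm_eq_iSup_norm (jointFun y ω)).symm
  rw [h x, h fun k => T (x k), eLpNorm_norm, eLpNorm_norm]
  exact eLpNorm_jointFun_map_le h1 hinf hp x
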